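/- Let λ ∈ ℂ, Ũ ∈ C^∞([b₁,b₃];ℂ), Ṽ₁ ∈ C^∞([b₁,b₂];ℂ), Ṽ₂ ∈ C^∞([b₂,b₃];ℂ). Then the following nonlocal Green formula with parameter λ holds: ∫_{b₁}^{b₂} (−Ũ'' + λ²Ũ)·conj(Ṽ₁) dφ + ∫_{b₂}^{b₃} (−Ũ'' + λ²Ũ)·conj(Ṽ₂) dφ + ( Ũ'(b₁) + α·iλ·exp((iλ−1) ln χ₁₂)·Ũ(b₂) )·conj(−Ṽ₁(b₁)) + (−Ũ'(b₃))·conj(−Ṽ₂(b₃)) + Ũ'(b₂)·( conj(Ṽ₁(b₂)) − conj(Ṽ₂(b₂)) ) = ∫_{b₁}^{b₂} Ũ·conj(−Ṽ₁'' + conj(λ)²·Ṽ₁) dφ + ∫_{b₂}^{b₃} Ũ·conj(−Ṽ₂'' + conj(λ)²·Ṽ₂) dφ + (−Ũ(b₁))·conj(Ṽ₁'(b₁)) + (−Ũ(b₃))·conj(−Ṽ₂'(b₃)) + Ũ(b₂)·conj( Ṽ₁'(b₂) − Ṽ₂'(b₂) + α·i·conj(λ)·exp((i·conj(λ)+1)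 ln χ'₂₁)·Ṽ₁(b₁) ). -/

import Mathlib

open MeasureTheory Real ComplexConjugate

noncomputable section

/-- `W : ℝ → ℂ` is smooth on an open neighbourhood of the set `s`
(the formalization of `W ∈ C^∞(s; ℂ)` for a closed interval `s`). -/
def SmoothNear1 (W : ℝ → ℂ) (s : Set ℝ) : Prop :=
  ∃ O : Set ℝ, IsOpen O ∧ s ⊆ O ∧ ContDiffOn ℝ (⊤ : ℕ∞) W O

theorem SmoothNear1.mono {W : ℝ → ℂ} {s t : Set ℝ} (hW : SmoothNear1 W t) (hst : s ⊆ t) :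
    SmoothNear1 W s :=
  let ⟨O, hO, htO, h⟩ := hW
  ⟨O, hO, hst.trans htO, h⟩

theorem SmoothNear1.deriv {W : ℝ → ℂ} {s : Set ℝ} (hW : SmoothNear1 W s) :
    SmoothNear1 (deriv W) s :=
  let ⟨O, hO, hsO, h⟩ := hW
  ⟨O, hO, hsO, h.deriv_of_isOpen hO le_rfl⟩

theorem SmoothNear1.continuousOn {W : ℝ → ℂ} {s : Set ℝ} (hW : SmoothNear1 W s) :
    ContinuousOn W s :=
  let ⟨_, _, hsO, h⟩ := hW
  h.continuousOn.mono hsO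

theorem SmoothNear1.hasDerivAt {W : ℝ → ℂ} {s : Set ℝ} (hW : SmoothNear1 W s) {x : ℝ}
    (hx : x ∈ s) : HasDerivAt W (_root_.deriv W x) x :=
  let ⟨_, hO, hsO, h⟩ := hW
  ((h.contDiffAt (hO.mem_nhds (hsO hx))).differentiableAt (by simp)).hasDerivAt

/-- Green's formula for the operator `-d²/dφ² + λ²` on an interval. -/
theorem integral_green_formula {a b : ℝ} (hab : a ≤ b) (lam : ℂ) {U V : ℝ → ℂ}
    (hU : SmoothNear1 U (Set.Icc a b)) (hV : SmoothNear1 V (Set.Icc a b)) :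
    (∫ φ in a..b, (-(deriv (deriv U) φ) + lam ^ 2 * U φ) * conj (V φ)) =
      (∫ φ in a..b, U φ * conj (-(deriv (deriv V) φ) + (conj lam) ^ 2 * V φ)) +
        ((U b * conj (deriv V b) - deriv U b * conj (V b)) -
          (U a * conj (deriv V a) - deriv U a * conj (V a))) := by
  have hI : Set.uIcc a b = Set.Icc a b := Set.uIcc_of_le hab
  have cU := hU.continuousOn
  have cV := hV.continuousOn
  have cU2 := hU.deriv.deriv.continuousOn
  have cV2 := hV.deriv.deriv.continuousOn
  have conj_continuousOn {f : ℝ → ℂ} (hf : ContinuousOn f (Set.Icc a b)) :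
      ContinuousOn (fun φ ↦ conj (f φ)) (Set.Icc a b) :=
    Complex.continuous_conj.comp_continuousOn hf
  have hL : IntervalIntegrable
      (fun φ ↦ (-(deriv (deriv U) φ) + lam ^ 2 * U φ) * conj (V φ)) volume a b :=
    ContinuousOn.intervalIntegrable
      (hI ▸ (cU2.neg.add (continuousOn_const.mul cU)).mul (conj_continuousOn cV))
  have hR : IntervalIntegrable
      (fun φ ↦ U φ * conj (-(deriv (deriv V) φ) + (conj lam) ^ 2 * V φ)) volume a b :=
    ContinuousOn.intervalIntegrable
      (hI ▸ cU.mul (conj_continuousOn (cV2.neg.add (continuousOn_const.mul cV))))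
  rw [← sub_eq_iff_eq_add', ← intervalIntegral.integral_sub hL hR]
  refine intervalIntegral.integral_eq_sub_of_hasDerivAt
    (f := fun φ ↦ U φ * conj (deriv V φ) - deriv U φ * conj (V φ)) (fun x hx ↦ ?_) (hL.sub hR)
  rw [hI] at hx
  have hconj {f : ℝ → ℂ} {f' : ℂ} (hf : HasDerivAt f f' x) :
      HasDerivAt (fun φ ↦ conj (f φ)) (conj f') x := by
    simpa using hf.star
  refine (((hU.hasDerivAt hx).mul (hconj (hV.deriv.hasDerivAt hx))).sub
    ((hU.deriv.hasDerivAt hx).mul (hconj (hV.hasDerivAt hx)))).congr_deriv ?_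
  simp only [map_add, map_neg, map_mul, map_pow, Complex.conj_conj]
  ring

/-- Nonlocal Green formula with spectral parameter `λ` on the arcs `(b₁, b₂)`, `(b₂, b₃)`,
corresponding to the nonlocal Neumann-type boundary condition. -/
theorem green_formula_nonlocal_parameter_lambda_neumann
    (b₁ b₂ b₃ : ℝ) (hb₀ : 0 < b₁) (hb₁₂ : b₁ < b₂) (hb₂₃ : b₂ < b₃) (hb₃ : b₃ < 2 * π)
    (α χ₁₂ : ℝ) (hχ : 0 < χ₁₂) (lam : ℂ)
    (U V₁ V₂ : ℝ → ℂ)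
    (hU : SmoothNear1 U (Set.Icc b₁ b₃))
    (hV₁ : SmoothNear1 V₁ (Set.Icc b₁ b₂))
    (hV₂ : SmoothNear1 V₂ (Set.Icc b₂ b₃)) :
    (∫ φ in b₁..b₂, (-(deriv (deriv U) φ) + lam ^ 2 * U φ) * conj (V₁ φ)) +
    (∫ φ in b₂..b₃, (-(deriv (deriv U) φ) + lam ^ 2 * U φ) * conj (V₂ φ)) +
    (deriv U b₁ + (α : ℂ) * (Complex.I * lam) *
        Complex.exp ((Complex.I * lam - 1) * (Real.log χ₁₂ : ℂ)) * U b₂) *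
      conj (-(V₁ b₁)) +
    (-(deriv U b₃)) * conj (-(V₂ b₃)) +
    deriv U b₂ * (conj (V₁ b₂) - conj (V₂ b₂)) =
    (∫ φ in b₁..b₂, U φ * conj (-(deriv (deriv V₁) φ) + (conj lam) ^ 2 * V₁ φ)) +
    (∫ φ in b₂..b₃, U φ * conj (-(deriv (deriv V₂) φ) + (conj lam) ^ 2 * V₂ φ)) +
    (-(U b₁)) * conj (deriv V₁ b₁) +
    (-(U b₃)) * conj (-(deriv V₂ b₃)) +
    U b₂ * conj (deriv V₁ b₂ - deriv V₂ b₂ +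
      (α : ℂ) * (Complex.I * conj lam) *
        Complex.exp ((Complex.I * conj lam + 1) * (Real.log (1 / χ₁₂) : ℂ)) * V₁ b₁) := by
  rw [integral_green_formula hb₁₂.le lam (hU.mono (Set.Icc_subset_Icc_right hb₂₃.le)) hV₁,
    integral_green_formula hb₂₃.le lam (hU.mono (Set.Icc_subset_Icc_left hb₁₂.le)) hV₂]
  have hexp : conj (Complex.exp ((Complex.I * conj lam + 1) * (Real.log (1 / χ₁₂) : ℂ))) =
      Complex.exp ((Complex.I * lam - 1) * (Real.log χ₁₂ : ℂ)) := by
    rw [← Complex.exp_conj, one_div, Real.log_inv]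
    congr 1
    simp only [map_add, map_mul, map_one, map_neg, Complex.conj_conj, Complex.conj_I,
      Complex.conj_ofReal, Complex.ofReal_neg]
    ring
  simp only [map_add, map_sub, map_neg, map_mul, hexp, Complex.conj_conj, Complex.conj_I,
    Complex.conj_ofReal]
  ring
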